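/- Define the (n,k)-th Catalan triangle polynomial evaluated at an integer d by F_{n,k}(d) = Σ_{s=0}^{k} C(n,s)·d^{k−s}, where C denotes the Catalan triangle number (with C(n,s)=0 for s > n). Then for all integers n ≥ 1, 0 ≤ k ≤ n, and d ≥ 1, one has C(n,k) = d·F_{n−1,k}(d) − (d−1)·F_{n,k}(d). -/

import Mathlib

/-- The Catalan triangle numbers: `C(n,k) = (n+k)! * (n-k+1) / (k! * (n+1)!)`,
with `C(n,k) = 0` for `k > n` (via truncated subtraction). -/
def catalanTriangle (n k : ℕ) : ℕ :=
  (n + k).factorial * (n + 1 - k) / (k.factorial * (n + 1).factorial)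

/-- The $(n,k)$-th Catalan triangle polynomial evaluated at $d$:
$\mathfrak{F}_{n,k}(d) = \sum_{s=0}^{k} C(n,s) d^{k-s}$. -/
def catalanTrianglePoly (n k : ℕ) (d : ℤ) : ℤ :=
  ∑ s ∈ Finset.range (k + 1), (catalanTriangle n s : ℤ) * d ^ (k - s)

theorem ct_zero (n : ℕ) : catalanTriangle n 0 = 1 := by
  unfold catalanTriangle
  have h := Nat.factorial_pos (n + 1)
  have e : (n + 0).factorial * (n + 1 - 0) = Nat.factorial 0 * (n + 1).factorial := by
    simp [Nat.factorial_succ, Nat.mul_comm]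
  rw [e]
  exact Nat.div_self (by simpa using h)

theorem ct_succ (n k : ℕ) (hk : k ≤ n) :
    catalanTriangle n (k + 1) + (n + k + 1).choose k = (n + k + 1).choose (k + 1) := by
  obtain ⟨m, rfl⟩ := Nat.exists_eq_add_of_le hk
  have h1 := Nat.choose_mul_factorial_mul_factorial (n := k + m + k + 1) (k := k + 1) (by omega)
  have h2 := Nat.choose_mul_factorial_mul_factorial (n := k + m + k + 1) (k := k) (by omega)
  rw [show k + m + k + 1 - (k + 1) = k + m by omega] at h1
  rw [show k + m + k + 1 - k = k + m + 1 by omega] at h2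
  have hle : (k + m + k + 1).choose k ≤ (k + m + k + 1).choose (k + 1) :=
    by
    have h3 := Nat.choose_succ_right_eq (k + m + k + 1) k
    rw [show k + m + k + 1 - k = k + m + 1 by omega] at h3
    refine Nat.le_of_mul_le_mul_right (c := k + 1) ?_ (by omega)
    rw [h3]
    exact Nat.mul_le_mul_left _ (by omega)
  obtain ⟨x, hx⟩ := Nat.exists_eq_add_of_le hle
  have key : (k + m + (k + 1)).factorial * (k + m + 1 - (k + 1))
      = x * ((k + 1).factorial * (k + m + 1).factorial) := by
    rw [show k + m + 1 - (k + 1) = m by omega, show k + m + (k + 1) = k + m + k + 1 by omega]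
    rw [hx] at h1
    rw [Nat.factorial_succ k] at h1 ⊢
    rw [Nat.factorial_succ (k + m)] at h2 ⊢
    zify at h1 h2 ⊢
    linear_combination ((k : ℤ) + 1) * h2 - ((k : ℤ) + m + 1) * h1
  unfold catalanTriangle
  rw [key, Nat.mul_div_cancel _ (by positivity), hx, Nat.add_comm]

theorem ct_rec (n k : ℕ) (hk : k ≤ n) :
    catalanTriangle (n + 1) (k + 1) = catalanTriangle (n + 1) k + catalanTriangle n (k + 1) := by
  cases k with
  | zero =>
    have h1 := ct_succ (n + 1) 0 (by omega)
    have h2 := ct_succ n 0 (by omega)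
    rw [ct_zero]
    simp only [Nat.zero_add, Nat.add_zero, Nat.choose_zero_right, Nat.choose_one_right] at h1 h2 ⊢
    omega
  | succ j =>
    have h1 := ct_succ (n + 1) (j + 1) (by omega)
    have h2 := ct_succ (n + 1) j (by omega)
    have h3 := ct_succ n (j + 1) (by omega)
    rw [show n + 1 + (j + 1) + 1 = (n + j + 2) + 1 by omega, Nat.choose_succ_succ' _ j,
      Nat.choose_succ_succ' _ (j + 1)] at h1
    rw [show n + 1 + j + 1 = n + j + 2 by omega] at h2
    rw [show n + (j + 1) + 1 = n + j + 2 by omega] at h3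
    omega

theorem ctp_succ (n k : ℕ) (d : ℤ) : catalanTrianglePoly n (k + 1) d
    = d * catalanTrianglePoly n k d + catalanTriangle n (k + 1) := by
  unfold catalanTrianglePoly
  rw [Finset.sum_range_succ, Finset.mul_sum]
  congr 1
  · apply Finset.sum_congr rfl
    intro s hs
    have : s ≤ k := by simpa [Nat.lt_succ_iff] using hs
    rw [show k + 1 - s = (k - s) + 1 by omega]
    ring
  · simp

theorem stmt_16 (n k : ℕ) (d : ℤ) (hn : 1 ≤ n) (hk : k ≤ n) (hd : 1 ≤ d) :
    (catalanTriangle n k : ℤ) =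
      d * catalanTrianglePoly (n - 1) k d - (d - 1) * catalanTrianglePoly n k d := by
  obtain ⟨m, rfl⟩ := Nat.exists_eq_add_of_le' hn
  rw [Nat.add_sub_cancel]
  induction k with
  | zero => simp [catalanTrianglePoly, ct_zero]
  | succ k ih =>
    have h := ih (by omega)
    have hr := ct_rec m k (by omega)
    rw [ctp_succ, ctp_succ]
    zify at hr
    linear_combination d * h + d * hr
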